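/- Let Ω ⊆ ℝ² be a nonempty open, simply connected set, let N : Ω → ℝ^{2×2} be a matrix field whose entries are twice continuously differentiable with N₁₂ = N₂₁ on Ω, and let q : Ω → ℝ be twice continuously differentiable with Δq(x) = divDiv N(x) for all x ∈ Ω. Then there exists a continuously differentiable vector field ψ : Ω → ℝ² such that N(x) = q(x) I + symCurl ψ(x) for all x ∈ Ω. -/

import Mathlib

noncomputable section

open MeasureTheory Matrix

/-- The plane `ℝ²` as a Euclidean space. -/
abbrev E2 := EuclideanSpace ℝ (Fin 2)

/-- Partial derivative `∂ᵢ f` of a scalar field. -/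
def pd (i : Fin 2) (f : E2 → ℝ) (x : E2) : ℝ :=
  fderiv ℝ f x (EuclideanSpace.single i 1)

/-- `Curl ψ`: the 2×2 matrix field with rows `(∂₂ψᵢ, −∂₁ψᵢ)`. -/
def CurlM (ψ : E2 → Fin 2 → ℝ) (x : E2) : Matrix (Fin 2) (Fin 2) ℝ :=
  Matrix.of fun i => ![pd 1 (fun y => ψ y i) x, -pd 0 (fun y => ψ y i) x]

/-- `symCurl ψ = ½(Curl ψ + (Curl ψ)ᵀ)`. -/
def symCurlM (ψ : E2 → Fin 2 → ℝ) (x : E2) : Matrix (Fin 2) (Fin 2) ℝ :=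
  (2⁻¹ : ℝ) • (CurlM ψ x + (CurlM ψ x)ᵀ)

/-- Row-wise divergence of a matrix field: `(Div N)ᵢ = ∂₁N_{i1} + ∂₂N_{i2}`. -/
def DivM (N : E2 → Matrix (Fin 2) (Fin 2) ℝ) (x : E2) : Fin 2 → ℝ :=
  fun i => pd 0 (fun y => N y i 0) x + pd 1 (fun y => N y i 1) x

/-- Divergence of a vector field: `div w = ∂₁w₁ + ∂₂w₂`. -/
def divV (w : E2 → Fin 2 → ℝ) (x : E2) : ℝ :=
  pd 0 (fun y => w y 0) x + pd 1 (fun y => w y 1) x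

/-- `divDiv N = div (Div N)`. -/
def divDivM (N : E2 → Matrix (Fin 2) (Fin 2) ℝ) (x : E2) : ℝ :=
  divV (fun y => DivM N y) x

/-- Hessian matrix `(∇²v)_{ij} = ∂ᵢ∂ⱼ v`. -/
def hessM (v : E2 → ℝ) (x : E2) : Matrix (Fin 2) (Fin 2) ℝ :=
  Matrix.of fun i j => pd i (fun y => pd j v y) x

/-- The Frobenius inner product `A : B = Σ_{ij} A_{ij} B_{ij}`. -/
def frob (A B : Matrix (Fin 2) (Fin 2) ℝ) : ℝ :=
  ∑ i : Fin 2, ∑ j : Fin 2, A i j * B i j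

open Topology Set

/-- On a simply connected, locally path connected space, local functions `f i` defined near `i`
whose differences are locally constant glue, up to locally constant functions, to a global one. -/
theorem exists_eventually_sub_eq_of_simplyConnected {X A : Type*} [TopologicalSpace X]
    [SimplyConnectedSpace X] [LocallyPathConnectedSpace X] [AddCommGroup A]
    (U : X → Set X) (hU : ∀ i, IsOpen (U i)) (hmem : ∀ i, i ∈ U i) (f : X → X → A)
    (hf : ∀ i j, ∀ x ∈ U i ∩ U j, ∀ᶠ y in 𝓝 x, f i y - f j y = f i x - f j x) :
    ∃ g : X → A, ∀ x, ∀ᶠ y in 𝓝 x, g y - f x y = g x - f x x := by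
  let : TopologicalSpace A := ⊥
  have : DiscreteTopology A := ⟨rfl⟩
  let Z : FiberBundleCore X X A :=
    { baseSet := U
      isOpen_baseSet := hU
      indexAt := id
      mem_baseSet_at := hmem
      coordChange := fun i j x v ↦ v + (f i x - f j x)
      coordChange_self := fun i x _ v ↦ by simp
      continuousOn_coordChange := fun i j ↦ by
        rintro ⟨x, v⟩ ⟨hx, -⟩
        have hconst : ContinuousAt (fun y ↦ f i y - f j y) x :=
          continuousAt_const.congr ((hf i j x hx).mono fun y hy ↦ hy.symm)
        have hfst : ContinuousAt (fun p : X × A ↦ f i p.1 - f j p.1) (x, v) :=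
          ContinuousAt.comp (x := (x, v)) (f := Prod.fst) hconst continuousAt_fst
        exact (continuousAt_snd.add hfst).continuousWithinAt
      coordChange_comp := fun i j k x _ v ↦ by abel }
  obtain ⟨x₀⟩ : Nonempty X := inferInstance
  have cov : IsCoveringMap (Bundle.TotalSpace.proj : Z.TotalSpace → X) :=
    FiberBundle.isCoveringMap
  obtain ⟨s, ⟨-, hs⟩, -⟩ :=
    cov.existsUnique_continuousMap_lifts (ContinuousMap.id X) x₀ ⟨x₀, (0 : A)⟩ rfl
  have hs' : ∀ x, (s x).proj = x := fun x ↦ congrFun hs x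
  let σ : X → A := fun x ↦ (s x).2
  have hcoord : ∀ x y, (Z.localTriv x (s y)).2 = σ y + (f y y - f x y) := by
    intro x y
    change σ y + (f (s y).proj (s y).proj - f x (s y).proj) = _
    rw [hs']
  refine ⟨fun x ↦ σ x + f x x, fun x ↦ ?_⟩
  have hcont : ContinuousAt (fun y ↦ (Z.localTriv x (s y)).2) x := by
    have hsrc : s x ∈ (Z.localTriv x).source := by
      rw [Z.mem_localTriv_source, hs']
      exact hmem x
    exact continuousAt_snd.comp
      (((Z.localTriv x).toOpenPartialHomeomorph.continuousAt hsrc).comp s.continuous.continuousAt)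
  filter_upwards [hcont.eventually (show {(Z.localTriv x (s x)).2} ∈ 𝓝 _ by simp)] with y hy
  have hy : (Z.localTriv x (s y)).2 = (Z.localTriv x (s x)).2 := hy
  rw [hcoord, hcoord] at hy
  rw [add_sub_assoc, hy, add_sub_assoc]

/-- **Poincaré lemma** for `1`-forms on a simply connected open set. -/
theorem exists_hasFDerivAt_of_fderiv_symmetric_of_simplyConnected {E F : Type*}
    [NormedAddCommGroup E] [NormedSpace ℝ E] [NormedAddCommGroup F] [NormedSpace ℝ F]
    [CompleteSpace F] {Ω : Set E} (hΩ : IsOpen Ω) (hsc : SimplyConnectedSpace Ω)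
    {ω : E → E →L[ℝ] F} (hω : DifferentiableOn ℝ ω Ω)
    (hdω : ∀ a ∈ Ω, ∀ x y, fderiv ℝ ω a x y = fderiv ℝ ω a y x) :
    ∃ f : E → F, ∀ a ∈ Ω, HasFDerivAt f (ω a) a := by
  classical
  have := hΩ.locallyPathConnectedSpace
  have hloc : ∀ i : Ω, ∃ r > 0, Metric.ball (i : E) r ⊆ Ω ∧
      ∃ f : E → F, ∀ a ∈ Metric.ball (i : E) r, HasFDerivAt f (ω a) a := by
    intro i
    obtain ⟨r, hr, hsub⟩ := Metric.isOpen_iff.1 hΩ i i.2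
    exact ⟨r, hr, hsub, (convex_ball _ _).exists_forall_hasFDerivAt_of_fderiv_symmetric
      Metric.isOpen_ball (hω.mono hsub) fun a ha ↦ hdω a (hsub ha)⟩
  choose r hr hsub f hf using hloc
  obtain ⟨g, hg⟩ := exists_eventually_sub_eq_of_simplyConnected
    (fun i : Ω ↦ ((↑) : Ω → E) ⁻¹' Metric.ball (i : E) (r i))
    (fun i ↦ Metric.isOpen_ball.preimage continuous_subtype_val)
    (fun i ↦ Metric.mem_ball_self (hr i)) (fun i x ↦ f i x) (by
      rintro i j x ⟨hxi, hxj⟩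
      obtain ⟨ε, hε, hball⟩ := Metric.isOpen_iff.1
        (Metric.isOpen_ball.inter Metric.isOpen_ball) (x : E) ⟨hxi, hxj⟩
      filter_upwards [continuous_subtype_val.continuousAt.preimage_mem_nhds
        (Metric.ball_mem_nhds (x : E) hε)] with y hy
      have hd : ∀ z ∈ Metric.ball (x : E) ε,
          HasFDerivWithinAt (fun z ↦ f i z - f j z) (0 : E →L[ℝ] F) (Metric.ball (x : E) ε) z := by
        intro z hz
        have h := (hf i z (hball hz).1).fun_sub (hf j z (hball hz).2)
        rw [sub_self] at h
        exact h.hasFDerivWithinAt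
      exact (convex_ball (x : E) ε).is_const_of_fderivWithin_eq_zero
        (fun z hz ↦ (hd z hz).differentiableWithinAt)
        (fun z hz ↦ (hd z hz).fderivWithin (Metric.isOpen_ball.uniqueDiffOn z hz)) hy
        (Metric.mem_ball_self hε))
  refine ⟨fun x ↦ if hx : x ∈ Ω then g ⟨x, hx⟩ else 0, fun a ha ↦ ?_⟩
  have key := ((hf ⟨a, ha⟩ a (Metric.mem_ball_self (hr ⟨a, ha⟩))).add_const
    (g ⟨a, ha⟩ - f ⟨a, ha⟩ a))
  refine key.congr_of_eventuallyEq ?_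
  have hev := hg ⟨a, ha⟩
  rw [nhds_subtype_eq_comap, Filter.eventually_comap] at hev
  filter_upwards [hev, hΩ.mem_nhds ha] with y hy hyΩ
  simp only [dif_pos hyΩ, ← hy ⟨y, hyΩ⟩ rfl]
  abel

theorem contDiffOn_pd {f : E2 → ℝ} {Ω : Set E2} {m n : WithTop ℕ∞} (hΩ : IsOpen Ω)
    (hf : ContDiffOn ℝ n f Ω) (hmn : m + 1 ≤ n) (i : Fin 2) : ContDiffOn ℝ m (pd i f) Ω :=
  (hf.fderiv_of_isOpen hΩ hmn).clm_apply contDiffOn_const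

theorem pd_add {f g : E2 → ℝ} {x : E2} (hf : DifferentiableAt ℝ f x)
    (hg : DifferentiableAt ℝ g x) (i : Fin 2) :
    pd i (fun y ↦ f y + g y) x = pd i f x + pd i g x := by
  simp [pd, fderiv_fun_add hf hg]

theorem pd_sub {f g : E2 → ℝ} {x : E2} (hf : DifferentiableAt ℝ f x)
    (hg : DifferentiableAt ℝ g x) (i : Fin 2) :
    pd i (fun y ↦ f y - g y) x = pd i f x - pd i g x := by
  simp [pd, fderiv_fun_sub hf hg]

/-- A divergence-free `C¹` field `(a, b)` on a simply connected plane domain has a stream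
function. -/
theorem exists_stream_function {Ω : Set E2} (hΩ : IsOpen Ω) (hsc : SimplyConnectedSpace Ω)
    {a b : E2 → ℝ} (ha : ContDiffOn ℝ 1 a Ω) (hb : ContDiffOn ℝ 1 b Ω)
    (hdiv : ∀ x ∈ Ω, pd 0 a x + pd 1 b x = 0) :
    ∃ φ : E2 → ℝ, ContDiffOn ℝ 1 φ Ω ∧ ∀ x ∈ Ω, pd 1 φ x = a x ∧ pd 0 φ x = -b x := by
  let P (i : Fin 2) : E2 →L[ℝ] ℝ := EuclideanSpace.proj i
  have hω : ContDiffOn ℝ 1 (fun x ↦ a x • P 1 - b x • P 0) Ω :=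
    (ha.smul contDiffOn_const).sub (hb.smul contDiffOn_const)
  obtain ⟨φ, hφ⟩ := exists_hasFDerivAt_of_fderiv_symmetric_of_simplyConnected hΩ hsc
    (hω.differentiableOn one_ne_zero) (by
      intro x hx u v
      have hax := ((ha.differentiableOn one_ne_zero) x hx).differentiableAt (hΩ.mem_nhds hx)
      have hbx := ((hb.differentiableOn one_ne_zero) x hx).differentiableAt (hΩ.mem_nhds hx)
      have hd := (hax.hasFDerivAt.smul_const (P 1)).fun_sub (hbx.hasFDerivAt.smul_const (P 0))
      have hexp : ∀ (L : E2 →L[ℝ] ℝ) (w : E2), L w =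
          w 0 * L (EuclideanSpace.single 0 1) + w 1 * L (EuclideanSpace.single 1 1) := by
        intro L w
        have hw : w = w 0 • EuclideanSpace.single 0 (1 : ℝ) +
            w 1 • EuclideanSpace.single 1 (1 : ℝ) := by
          ext i; fin_cases i <;> simp
        conv_lhs => rw [hw]
        simp
      have hzero := hdiv x hx
      simp only [pd] at hzero
      rw [hd.fderiv]
      simp only [P, _root_.sub_apply, ContinuousLinearMap.smulRight_apply,
        _root_.smul_apply, PiLp.proj_apply, smul_eq_mul]
      rw [hexp (fderiv ℝ a x) u, hexp (fderiv ℝ a x) v, hexp (fderiv ℝ b x) u,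
        hexp (fderiv ℝ b x) v]
      linear_combination (u 0 * v 1 - u 1 * v 0) * hzero)
  refine ⟨φ, ?_, fun x hx ↦ by simp [pd, (hφ x hx).fderiv, P]⟩
  rw [show (1 : WithTop ℕ∞) = 0 + 1 by simp, contDiffOn_succ_iff_fderiv_of_isOpen hΩ]
  refine ⟨fun x hx ↦ (hφ x hx).differentiableAt.differentiableWithinAt, by simp, ?_⟩
  exact contDiffOn_zero.2 (hω.continuousOn.congr fun x hx ↦ (hφ x hx).fderiv)

/-- On a nonempty open simply connected set `Ω ⊆ ℝ²`, every symmetric matrix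
field `N` with `C²` entries decomposes as `N = q I + symCurl ψ`, where `q` is twice
continuously differentiable with `Δq = divDiv N` on `Ω`. -/
theorem regular_decomposition (Ω : Set E2) (hne : Ω.Nonempty)
    (hΩ : IsOpen Ω) (hsc : SimplyConnectedSpace Ω)
    (N : E2 → Matrix (Fin 2) (Fin 2) ℝ)
    (hN : ∀ i j, ContDiffOn ℝ 2 (fun x => N x i j) Ω)
    (hsym : ∀ x ∈ Ω, N x 0 1 = N x 1 0)
    (q : E2 → ℝ) (hq : ContDiffOn ℝ 2 q Ω)
    (hlap : ∀ x ∈ Ω,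
      pd 0 (fun y => pd 0 q y) x + pd 1 (fun y => pd 1 q y) x = divDivM N x) :
    ∃ ψ : E2 → Fin 2 → ℝ, ContDiffOn ℝ 1 ψ Ω ∧
      ∀ x ∈ Ω, N x = q x • (1 : Matrix (Fin 2) (Fin 2) ℝ) + symCurlM ψ x := by
  have hdiff : ∀ {f : E2 → ℝ} {n : WithTop ℕ∞}, ContDiffOn ℝ n f Ω → n ≠ 0 →
      ∀ x ∈ Ω, DifferentiableAt ℝ f x := fun hf hn x hx ↦
    (hf.differentiableOn hn x hx).differentiableAt (hΩ.mem_nhds hx)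
  have hD : ∀ {f : E2 → ℝ}, ContDiffOn ℝ 2 f Ω → ∀ i, ContDiffOn ℝ 1 (pd i f) Ω :=
    fun hf i ↦ contDiffOn_pd hΩ hf (by norm_num) i
  have hDN (i : Fin 2) : ContDiffOn ℝ 1 (fun x ↦ DivM N x i) Ω :=
    (hD (hN i 0) 0).add (hD (hN i 1) 1)
  obtain ⟨φ, hφ, hφd⟩ := exists_stream_function hΩ hsc
    ((hDN 0).sub (hD hq 0)) ((hDN 1).sub (hD hq 1)) (by
      intro x hx
      rw [pd_sub (hdiff (hDN 0) one_ne_zero x hx) (hdiff (hD hq 0) one_ne_zero x hx),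
        pd_sub (hdiff (hDN 1) one_ne_zero x hx) (hdiff (hD hq 1) one_ne_zero x hx)]
      have h := hlap x hx
      simp only [divDivM, divV] at h
      linear_combination -h)
  have hN1 (i j : Fin 2) : ContDiffOn ℝ 1 (fun x ↦ N x i j) Ω := (hN i j).of_le one_le_two
  have hq1 : ContDiffOn ℝ 1 q Ω := hq.of_le one_le_two
  obtain ⟨ψ₀, hψ₀, hψ₀d⟩ := exists_stream_function hΩ hsc
    ((hN1 0 0).sub hq1) ((hN1 0 1).sub hφ) (by
      intro x hx
      rw [pd_sub (hdiff (hN1 0 0) one_ne_zero x hx) (hdiff hq1 one_ne_zero x hx),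
        pd_sub (hdiff (hN1 0 1) one_ne_zero x hx) (hdiff hφ one_ne_zero x hx), (hφd x hx).1]
      simp only [DivM]
      ring)
  obtain ⟨ψ₁, hψ₁, hψ₁d⟩ := exists_stream_function hΩ hsc
    ((hN1 1 0).add hφ) ((hN1 1 1).sub hq1) (by
      intro x hx
      rw [pd_add (hdiff (hN1 1 0) one_ne_zero x hx) (hdiff hφ one_ne_zero x hx),
        pd_sub (hdiff (hN1 1 1) one_ne_zero x hx) (hdiff hq1 one_ne_zero x hx), (hφd x hx).2]
      simp only [DivM]
      ring)
  refine ⟨fun x ↦ ![ψ₀ x, ψ₁ x], contDiffOn_pi.2 fun i ↦ ?_, fun x hx ↦ ?_⟩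
  · fin_cases i
    · exact hψ₀
    · exact hψ₁
  · obtain ⟨h₀₁, h₀₀⟩ := hψ₀d x hx
    obtain ⟨h₁₁, h₁₀⟩ := hψ₁d x hx
    have hs := hsym x hx
    ext i j
    fin_cases i <;> fin_cases j <;>
      simp [symCurlM, CurlM, h₀₁, h₀₀, h₁₁, h₁₀] <;> linarith
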